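/- arXiv:math/0503492 — 2 statements merged into one kernel-verified Lean document; each statement's English description precedes it below -/
import Mathlib

section
/- The canonical group homomorphism from Iso^pr(var/X) to K_0(var/X), sending the class of a proper morphism [X' → X] to its class in K_0(var/X), kills the acyclicity relations (ac) and induces a group isomorphism from the quotient Iso^pr(var/X)/(ac) onto K_0(var/X). -/
/-!
STATEMENT 0: Let `k` be a field of characteristic `0` and `X` a variety over `k`
(a reduced separated scheme of finite type over `k`).  The canonical group
homomorphism from `Iso^pr(var/X)` (the free abelian group on isomorphism classes of
proper morphisms `X' → X` of `k`-varieties) to the relative Grothendieck group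
`K₀(var/X)` kills the acyclicity relations (ac) and induces a group isomorphism
`Iso^pr(var/X)/(ac) ≅ K₀(var/X)`.
-/

open AlgebraicGeometry CategoryTheory

/-- A variety over the field `k`: a reduced scheme, separated and of finite type
(locally of finite type and quasi-compact) over `Spec k`. -/
structure Var (k : Type) [Field k] [CharZero k] where
  X : Scheme
  str : X ⟶ Scheme.Spec.obj (Opposite.op (CommRingCat.of k))
  reduced : IsReduced X
  separated : IsSeparated str
  locallyOfFiniteType : LocallyOfFiniteType str
  quasiCompact : QuasiCompact str

variable (k : Type) [Field k] [CharZero k]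

/-- A variety over `X`: a variety `src` together with a morphism `src → X` over `k`. -/
structure VarOver (X : Var k) where
  src : Var k
  hom : src.X ⟶ X.X
  w : hom ≫ X.str = src.str

variable {k}

/-- The elements of the free abelian group identifying isomorphic varieties over `X`. -/
def isoRel (X : Var k) : Set (FreeAbelianGroup (VarOver k X)) :=
  {a | ∃ (Y Z : VarOver k X) (e : Y.src.X ≅ Z.src.X), e.hom ≫ Z.hom = Y.hom ∧
    a = FreeAbelianGroup.of Y - FreeAbelianGroup.of Z}

/-- The additivity relations `[Y → X] = [Z → X] + [Y∖Z → X]` for `Z ⊆ Y` a closed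
subvariety with open complement `Y∖Z`. -/
def addRel (X : Var k) : Set (FreeAbelianGroup (VarOver k X)) :=
  {a | ∃ (Y Z U : VarOver k X) (i : Z.src.X ⟶ Y.src.X) (j : U.src.X ⟶ Y.src.X),
    IsClosedImmersion i ∧ IsOpenImmersion j ∧
    i ≫ Y.hom = Z.hom ∧ j ≫ Y.hom = U.hom ∧
    Set.range j.base = (Set.range i.base)ᶜ ∧
    a = FreeAbelianGroup.of Y - FreeAbelianGroup.of Z - FreeAbelianGroup.of U}

/-- The relative Grothendieck group `K₀(var/X)` of varieties over `X`. -/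
def K0Var (X : Var k) : Type 1 :=
  FreeAbelianGroup (VarOver k X) ⧸ AddSubgroup.closure (isoRel X ∪ addRel X)

instance (X : Var k) : AddCommGroup (K0Var X) :=
  QuotientAddGroup.Quotient.addCommGroup _

/-- The class `[Y → X] ∈ K₀(var/X)`. -/
def K0Var.mk {X : Var k} (Y : VarOver k X) : K0Var X :=
  QuotientAddGroup.mk (FreeAbelianGroup.of Y)

/-- A variety proper over `X` (a generator of `Iso^pr(var/X)`). -/
structure PropOver (X : Var k) extends VarOver k X where
  proper : IsProper hom

/-- The elements identifying isomorphic proper varieties over `X`. -/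
def isoRelPr (X : Var k) : Set (FreeAbelianGroup (PropOver X)) :=
  {a | ∃ (Y Z : PropOver X) (e : Y.src.X ≅ Z.src.X), e.hom ≫ Z.hom = Y.hom ∧
    a = FreeAbelianGroup.of Y - FreeAbelianGroup.of Z}

/-- The acyclicity relations (ac): `[∅ → X] = 0`, and
`[X̃' → X] − [Z̃' → X] = [X' → X] − [Z' → X]` whenever `q : X̃' → X'` is proper,
`i : Z' → X'` is a closed embedding, `Z̃' = q⁻¹(Z')` (with its reduced structure,
i.e. the fiber product of `q` and `i` in varieties), and `q` restricts to an
isomorphism `X̃'∖Z̃' → X'∖Z'`. -/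
def acRel (X : Var k) : Set (FreeAbelianGroup (PropOver X)) :=
  {a | (∃ E : PropOver X, IsEmpty E.src.X.carrier ∧ a = FreeAbelianGroup.of E) ∨
    (∃ (X' Xt Z' Zt : PropOver X)
      (q : Xt.src.X ⟶ X'.src.X) (i : Z'.src.X ⟶ X'.src.X) (it : Zt.src.X ⟶ Xt.src.X),
      IsProper q ∧ IsClosedImmersion i ∧ IsClosedImmersion it ∧
      q ≫ X'.hom = Xt.hom ∧ i ≫ X'.hom = Z'.hom ∧ it ≫ Xt.hom = Zt.hom ∧
      -- `Z̃'` is the preimage of `Z'` under `q` (with its reduced structure)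
      Set.range it.base = q.base ⁻¹' (Set.range i.base) ∧
      -- `q` restricts to an isomorphism `X̃'∖Z̃' → X'∖Z'`
      (∃ (U V : Var k) (ju : U.X ⟶ Xt.src.X) (jv : V.X ⟶ X'.src.X) (e : U.X ≅ V.X),
        IsOpenImmersion ju ∧ IsOpenImmersion jv ∧
        Set.range ju.base = (Set.range it.base)ᶜ ∧
        Set.range jv.base = (Set.range i.base)ᶜ ∧
        ju ≫ q = e.hom ≫ jv) ∧
      a = (FreeAbelianGroup.of Xt - FreeAbelianGroup.of Zt) -
        (FreeAbelianGroup.of X' - FreeAbelianGroup.of Z'))}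

/-- The quotient `Iso^pr(var/X)/(ac)` of the free abelian group on isomorphism classes
of proper morphisms `X' → X` by the acyclicity relations. -/
def IsoPrQuot (X : Var k) : Type 1 :=
  FreeAbelianGroup (PropOver X) ⧸ AddSubgroup.closure (isoRelPr X ∪ acRel X)

instance (X : Var k) : AddCommGroup (IsoPrQuot X) :=
  QuotientAddGroup.Quotient.addCommGroup _

/-- The class of a proper morphism `[X' → X]` in `Iso^pr(var/X)/(ac)`. -/
def IsoPrQuot.mk {X : Var k} (P : PropOver X) : IsoPrQuot X :=
  QuotientAddGroup.mk (FreeAbelianGroup.of P)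

section Content
/-! ### Abstract finitely additive contents -/
open Set

variable {α : Type*} [TopologicalSpace α] {G : Type*} [AddCommGroup G]

/-- The content of `A` computed along the list of open sets `L`. -/
def ccont (m : Set α → G) : List (Set α) → Set α → G
  | [], _ => 0
  | U :: L, A => m (A ∩ U) + ccont m L (A \ U)

/-- finite additivity on good sets -/
def IsCont (m : Set α → G) (good : Set α → Prop) : Prop :=
  ∀ S C, good S → IsClosed C → good (S ∩ C) ∧ good (S \ C) ∧ m S = m (S ∩ C) + m (S \ C)

variable {m : Set α → G} {good : Set α → Prop}

lemma IsCont.empty (h : IsCont m good) (h0 : good ∅) : m ∅ = 0 := by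
  have := (h ∅ ∅ h0 isClosed_empty).2.2
  simpa using this

lemma IsCont.openInter (h : IsCont m good) {S U : Set α} (hS : good S) (hU : IsOpen U) :
    good (S ∩ U) ∧ good (S \ U) ∧ m S = m (S ∩ U) + m (S \ U) := by
  have := h S Uᶜ hS hU.isClosed_compl
  rw [Set.sdiff_compl, ← Set.sdiff_eq, add_comm] at this
  tauto

lemma ccont_split (h : IsCont m good) (L : List (Set α)) (hL : ∀ U ∈ L, IsOpen U)
    (A C : Set α) (hA : ∀ U ∈ L, good (A ∩ U)) (hC : IsClosed C) :
    ccont m L A = ccont m L (A ∩ C) + ccont m L (A \ C) := by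
  induction L generalizing A with
  | nil => simp [ccont]
  | cons U L ih =>
    simp only [ccont]
    rw [ih (fun V hV => hL V (by simp [hV])) (A \ U), (h (A ∩ U) C (hA U (by simp)) hC).2.2]
    · have e1 : A ∩ U ∩ C = A ∩ C ∩ U := by ext; simp; tauto
      have e2 : (A ∩ U) \ C = (A \ C) ∩ U := by ext; simp; tauto
      have e3 : (A \ U) ∩ C = (A ∩ C) \ U := by ext; simp; tauto
      have e4 : (A \ U) \ C = (A \ C) \ U := by ext; simp; tauto
      rw [e1, e2, e3, e4]; abel
    · intro V hV
      have e : (A \ U) ∩ V = (A ∩ V) \ U := by ext; simp; tauto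
      rw [e]
      exact (h.openInter (hA V (by simp [hV])) (hL U (by simp))).2.1

lemma ccont_good (h : IsCont m good) (L : List (Set α)) (hL : ∀ U ∈ L, IsOpen U)
    (S : Set α) (hS : good S) (hc : ∀ x ∈ S, ∃ U ∈ L, x ∈ U) :
    ccont m L S = m S := by
  induction L generalizing S with
  | nil =>
    have : S = ∅ := by
      ext x; simp; intro hx; simpa using hc x hx
    subst this
    simp [ccont, h.empty hS]
  | cons U L ih =>
    have := h.openInter hS (hL U (by simp))
    simp only [ccont]
    rw [ih (fun V hV => hL V (by simp [hV])) _ this.2.1, ← this.2.2]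
    rintro x ⟨hx, hxU⟩
    obtain ⟨V, hV, hxV⟩ := hc x hx
    simp only [List.mem_cons] at hV
    rcases hV with rfl | hV
    · exact absurd hxV hxU
    · exact ⟨V, hV, hxV⟩

lemma ccont_eq (h : IsCont m good) (h0 : good ∅)
    (L L' : List (Set α)) (hL : ∀ U ∈ L, IsOpen U) (hL' : ∀ U ∈ L', IsOpen U)
    (A : Set α) (hA : ∀ U ∈ L, good (A ∩ U)) (hA' : ∀ U ∈ L', good (A ∩ U))
    (hc : ∀ x ∈ A, ∃ U ∈ L, x ∈ U) (hc' : ∀ x ∈ A, ∃ U ∈ L', x ∈ U) :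
    ccont m L A = ccont m L' A := by
  induction L generalizing A with
  | nil =>
    have : A = ∅ := by
      ext x; simp; intro hx; simpa using hc x hx
    subst this
    rw [ccont_good h L' hL' ∅ h0 hc', h.empty h0]; rfl
  | cons U L ih =>
    have hU := hL U (by simp)
    have key : ∀ V, good (A ∩ V) → good ((A \ U) ∩ V) := by
      intro V hV
      have e : (A \ U) ∩ V = (A ∩ V) \ U := by ext; simp; tauto
      rw [e]
      exact (h.openInter hV hU).2.1
    simp only [ccont]
    rw [ih (fun V hV => hL V (by simp [hV])) (A \ U), ccont_split h L' hL' A Uᶜ hA' hU.isClosed_compl,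
      ← Set.sdiff_eq, Set.sdiff_compl, add_comm]
    · congr 1
      exact (ccont_good h L' hL' _ (hA U (by simp)) (fun x hx => hc' x hx.1)).symm
    · exact fun V hV => key V (hA V (by simp [hV]))
    · exact fun V hV => key V (hA' V hV)
    · rintro x ⟨hx, hxU⟩
      obtain ⟨V, hV, hxV⟩ := hc x hx
      simp only [List.mem_cons] at hV
      rcases hV with rfl | hV
      · exact absurd hxV hxU
      · exact ⟨V, hV, hxV⟩
    · exact fun x hx => hc' x hx.1

end Content

section SchemeLemmas
open Limits

/-- A morphism from a reduced scheme whose range lies in that of an immersion factors. -/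
lemma exists_lift_imm {T T' Y : Scheme.{0}} [IsReduced T'] (f : T ⟶ Y) [IsImmersion f]
    (g : T' ⟶ Y) (h : Set.range g ⊆ Set.range f) : ∃ l : T' ⟶ T, l ≫ f = g := by
  have hr : Set.range (pullback.fst g f) = Set.univ := by
    rw [Scheme.Pullback.range_fst]
    ext x; simpa using h ⟨x, rfl⟩
  have h1 : IsClosedImmersion (pullback.fst g f) :=
    .of_isPreimmersion _ (by rw [hr]; exact isClosed_univ)
  have h2 : Surjective (pullback.fst g f) := ⟨Set.range_eq_univ.mp hr⟩
  have := isIso_of_isClosedImmersion_of_surjective (pullback.fst g f)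
  exact ⟨inv (pullback.fst g f) ≫ pullback.snd g f, by simp [← pullback.condition]⟩

lemma exists_iso_imm {T T' Y : Scheme.{0}} [IsReduced T] [IsReduced T'] (f : T ⟶ Y) [IsImmersion f]
    (g : T' ⟶ Y) [IsImmersion g] (h : Set.range g = Set.range f) :
    ∃ l : T' ≅ T, l.hom ≫ f = g := by
  obtain ⟨a, ha⟩ := exists_lift_imm f g h.le
  obtain ⟨b, hb⟩ := exists_lift_imm g f h.ge
  refine ⟨⟨a, b, ?_, ?_⟩, ha⟩
  · rw [← cancel_mono g]; simp [ha, hb]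
  · rw [← cancel_mono f]; simp [ha, hb]

lemma isReduced_vanishing {Y : Scheme.{0}} (C : TopologicalSpace.Closeds Y) :
    IsReduced (Scheme.IdealSheafData.vanishingIdeal C).subscheme := by
  set I := Scheme.IdealSheafData.vanishingIdeal C
  have (i : Y.affineOpens) : IsReduced (I.subschemeCover.openCover.X i) := by
    change IsReduced (Spec (.of ((Y.presheaf.obj (.op i.1)) ⧸ I.ideal i)))
    have : _root_.IsReduced ((Y.presheaf.obj (.op i.1)) ⧸ I.ideal i) := by
      rw [← Ideal.isRadical_iff_quotient_reduced]
      simp only [I, Scheme.IdealSheafData.vanishingIdeal_ideal]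
      exact PrimeSpectrum.isRadical_vanishingIdeal _
    have : _root_.IsReduced (CommRingCat.of ((Y.presheaf.obj (.op i.1)) ⧸ I.ideal i)) := this
    infer_instance
  exact @IsReduced.of_openCover _ I.subschemeCover.openCover this

lemma exists_closed {Y : Scheme.{0}} (C : Set Y) (hC : IsClosed C) :
    ∃ (T : Scheme.{0}) (i : T ⟶ Y), IsReduced T ∧ IsClosedImmersion i ∧ Set.range i = C :=
  ⟨_, (Scheme.IdealSheafData.vanishingIdeal ⟨C, hC⟩).subschemeι, isReduced_vanishing _,
    inferInstance, by simp⟩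

lemma exists_open {Y : Scheme.{0}} [IsReduced Y] (U : Set Y) (hU : IsOpen U) :
    ∃ (T : Scheme.{0}) (i : T ⟶ Y), IsReduced T ∧ IsOpenImmersion i ∧ Set.range i = U :=
  ⟨_, Scheme.Opens.ι ⟨U, hU⟩, inferInstance, inferInstance, by simp⟩

/-- factor a quasi-compact immersion of a reduced scheme as dense open then closed -/
lemma exists_dense_closure {T Y : Scheme.{0}} [IsReduced T] (f : T ⟶ Y) [IsImmersion f]
    [QuasiCompact f] :
    ∃ (W : Scheme.{0}) (j : T ⟶ W) (i : W ⟶ Y), IsReduced W ∧ IsOpenImmersion j ∧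
      IsClosedImmersion i ∧ DenseRange j ∧ j ≫ i = f := by
  refine ⟨f.image, f.toImage, f.imageι, ?_, inferInstance, inferInstance, ?_, by simp⟩
  · have e : f.toImage.toImage ≫ f.toImage.imageι ≫ f.imageι = f := by simp
    have h1 : (f.toImage.imageι ≫ f.imageι).ker = f.imageι.ker := by
      apply le_antisymm
      · have := (Scheme.Hom.le_ker_comp f.toImage.toImage (f.toImage.imageι ≫ f.imageι))
        rw [e] at this
        simpa [Scheme.Hom.imageι] using this
      · exact Scheme.Hom.le_ker_comp _ _
    have h2 : IsIso f.toImage.imageι :=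
      IsClosedImmersion.isIso_of_ker_eq (f.toImage.imageι ≫ f.imageι) f.imageι _ rfl h1
    have : IsSchemeTheoreticallyDominant f.toImage :=
      ⟨(Scheme.isIso_subschemeι_iff_eq_bot _).mp h2⟩
    exact IsSchemeTheoreticallyDominant.isReduced f.toImage
  · exact f.toImage.denseRange

/-- If `j : T → W` is dense, `q : W → P` separated and `j ≫ q` is an open immersion,
then the preimage of the range of `j ≫ q` is the range of `j`. -/
lemma preimage_range_dense {T W P : Scheme.{0}} (j : T ⟶ W) (q : W ⟶ P) [IsOpenImmersion (j ≫ q)]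
    [IsSeparated q] (hd : DenseRange j) : q ⁻¹' (Set.range (j ≫ q)) = Set.range j := by
  let s : T ⟶ pullback q (j ≫ q) := pullback.lift j (𝟙 T) (by simp)
  have hs : s ≫ pullback.snd q (j ≫ q) = 𝟙 T := pullback.lift_snd _ _ _
  have hs' : s ≫ pullback.fst q (j ≫ q) = j := pullback.lift_fst _ _ _
  have : IsClosedImmersion (s ≫ pullback.snd q (j ≫ q)) := by rw [hs]; infer_instance
  have hcl : IsClosedImmersion s := .of_comp s (pullback.snd q (j ≫ q))
  have hsd : Dense (Set.range s) := by
    have h1 : Dense (Set.range j) := hd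
    have h2 := h1.preimage (pullback.fst q (j ≫ q)).isOpenEmbedding.isOpenMap
    refine h2.mono ?_
    rintro x ⟨t, ht⟩
    refine ⟨t, (pullback.fst q (j ≫ q)).isOpenEmbedding.injective ?_⟩
    rw [← ht, ← Scheme.Hom.comp_apply, hs']
  have hsu : Set.range s = Set.univ := by
    rw [← s.isClosedEmbedding.isClosed_range.closure_eq]; exact hsd.closure_eq
  apply subset_antisymm
  · intro w hw
    rw [← Scheme.Pullback.range_fst] at hw
    obtain ⟨x, rfl⟩ := hw
    obtain ⟨t, rfl⟩ := hsu.ge (Set.mem_univ x)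
    exact ⟨t, by rw [← Scheme.Hom.comp_apply, hs']⟩
  · rintro _ ⟨t, rfl⟩
    exact ⟨t, by simp⟩

end SchemeLemmas

section Val
open Limits

instance Var.instRed (Y : Var k) : IsReduced Y.X := Y.reduced

lemma Var.isNoeth (Y : Var k) : IsNoetherian Y.X := by
  have h1 := Y.locallyOfFiniteType
  have h2 := Y.quasiCompact
  have h3 : IsNoetherian (Spec (CommRingCat.of k)) := inferInstance
  have h4 : IsLocallyNoetherian (Scheme.Spec.obj (Opposite.op (CommRingCat.of k))) :=
    h3.toIsLocallyNoetherian
  have h5 : CompactSpace (Scheme.Spec.obj (Opposite.op (CommRingCat.of k))) :=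
    inferInstanceAs (CompactSpace (Spec (CommRingCat.of k)))
  have := LocallyOfFiniteType.isLocallyNoetherian Y.str
  have : CompactSpace Y.X := QuasiCompact.compactSpace_of_compactSpace Y.str
  exact ⟨⟩

attribute [local instance] Var.isNoeth

lemma exists_noeth_imm {T Y : Scheme.{0}} [IsNoetherian Y] (f : T ⟶ Y) [IsImmersion f] :
    IsNoetherian T := by
  have := LocallyOfFiniteType.isLocallyNoetherian f
  have : TopologicalSpace.NoetherianSpace T :=
    f.isEmbedding.isInducing.noetherianSpace
  exact ⟨⟩

lemma qc_imm {T Y : Scheme.{0}} [IsNoetherian Y] (f : T ⟶ Y) [IsImmersion f] :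
    QuasiCompact f := by
  have := exists_noeth_imm f
  infer_instance

/-- The variety over `X` given by an immersion from a reduced scheme. -/
noncomputable def VarOver.ofImm {X : Var k} (Y : VarOver k X) {T : Scheme.{0}} (hT : IsReduced T)
    (f : T ⟶ Y.src.X) (hf : IsImmersion f) : VarOver k X where
  src :=
    { X := T
      str := f ≫ Y.src.str
      reduced := hT
      separated := by have := Y.src.separated; infer_instance
      locallyOfFiniteType := by have := Y.src.locallyOfFiniteType; infer_instance
      quasiCompact := by have := Y.src.quasiCompact; have := qc_imm f; infer_instance }
  hom := f ≫ Y.hom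
  w := by simp [Y.w]

/-- The proper variety over `X` given by a closed immersion from a reduced scheme. -/
noncomputable def PropOver.ofClosed {X : Var k} (Y : PropOver X) {T : Scheme.{0}} (hT : IsReduced T)
    (f : T ⟶ Y.src.X) (hf : IsClosedImmersion f) : PropOver X where
  toVarOver := Y.toVarOver.ofImm hT f inferInstance
  proper := by have := Y.proper; change IsProper (f ≫ Y.hom); infer_instance

/-- A proper variety from a reduced scheme proper over `X`. -/
noncomputable def PropOver.ofProper (X : Var k) {T : Scheme.{0}} (hT : IsReduced T)
    (f : T ⟶ X.X) (hf : IsProper f) : PropOver X where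
  src :=
    { X := T
      str := f ≫ X.str
      reduced := hT
      separated := by have := X.separated; infer_instance
      locallyOfFiniteType := by have := X.locallyOfFiniteType; infer_instance
      quasiCompact := by have := X.quasiCompact; infer_instance }
  hom := f
  w := rfl
  proper := hf

variable {X : Var k}

/-- `q` is a value of the inverse map at `T`, computed by a compactification. -/
def IsVal (T : VarOver k X) (v : IsoPrQuot X) : Prop :=
  ∃ (P C : PropOver X) (j : T.src.X ⟶ P.src.X) (i : C.src.X ⟶ P.src.X),
    IsOpenImmersion j ∧ IsClosedImmersion i ∧ j ≫ P.hom = T.hom ∧ i ≫ P.hom = C.hom ∧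
    Set.range j = (Set.range i)ᶜ ∧ v = IsoPrQuot.mk P - IsoPrQuot.mk C

lemma IsoPrQuot.rel {a : FreeAbelianGroup (PropOver X)} (h : a ∈ isoRelPr X ∪ acRel X) :
    (QuotientAddGroup.mk a : FreeAbelianGroup (PropOver X) ⧸
      AddSubgroup.closure (isoRelPr X ∪ acRel X)) = 0 :=
  (QuotientAddGroup.eq_zero_iff _).mpr (AddSubgroup.subset_closure h)

lemma IsoPrQuot.ac (X' Xt Z' Zt : PropOver X)
      (q : Xt.src.X ⟶ X'.src.X) (i : Z'.src.X ⟶ X'.src.X) (it : Zt.src.X ⟶ Xt.src.X)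
      (h1 : IsProper q) (h2 : IsClosedImmersion i) (h3 : IsClosedImmersion it)
      (h4 : q ≫ X'.hom = Xt.hom) (h5 : i ≫ X'.hom = Z'.hom) (h6 : it ≫ Xt.hom = Zt.hom)
      (h7 : Set.range it = q ⁻¹' (Set.range i))
      (h8 : ∃ (U V : Var k) (ju : U.X ⟶ Xt.src.X) (jv : V.X ⟶ X'.src.X) (e : U.X ≅ V.X),
        IsOpenImmersion ju ∧ IsOpenImmersion jv ∧
        Set.range ju = (Set.range it)ᶜ ∧
        Set.range jv = (Set.range i)ᶜ ∧
        ju ≫ q = e.hom ≫ jv) :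
    IsoPrQuot.mk Xt - IsoPrQuot.mk Zt = IsoPrQuot.mk X' - IsoPrQuot.mk Z' := by
  rw [← sub_eq_zero]
  exact IsoPrQuot.rel (Or.inr (Or.inr ⟨X', Xt, Z', Zt, q, i, it, h1, h2, h3, h4, h5, h6, h7,
    h8, rfl⟩))

/-- comparison of a compactification with a dominating one -/
lemma val_step (T : VarOver k X) (P C W : PropOver X) (j : T.src.X ⟶ P.src.X)
    (i : C.src.X ⟶ P.src.X) (hj : IsOpenImmersion j) (hi : IsClosedImmersion i)
    (hiP : i ≫ P.hom = C.hom)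
    (hr : Set.range j = (Set.range i)ᶜ) (jW : T.src.X ⟶ W.src.X) (hjW : IsOpenImmersion jW)
    (hd : DenseRange jW) (q : W.src.X ⟶ P.src.X) (hq : q ≫ P.hom = W.hom) (hjq : jW ≫ q = j)
    (D : PropOver X) (iD : D.src.X ⟶ W.src.X) (hiD : IsClosedImmersion iD)
    (hiDW : iD ≫ W.hom = D.hom) (hrD : Set.range iD = (Set.range jW)ᶜ) :
    IsoPrQuot.mk P - IsoPrQuot.mk C = IsoPrQuot.mk W - IsoPrQuot.mk D := by
  have hPp := P.proper
  have hWp := W.proper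
  have hqp : IsProper q := by
    have : IsProper (q ≫ P.hom) := by rw [hq]; exact hWp
    exact IsProper.of_comp q P.hom
  have hpre : q ⁻¹' (Set.range j) = Set.range jW := by
    have : IsOpenImmersion (jW ≫ q) := by rw [hjq]; exact hj
    have := preimage_range_dense jW q hd
    rwa [hjq] at this
  symm
  refine IsoPrQuot.ac P W C D q i iD hqp hi hiD hq hiP hiDW ?_
    ⟨T.src, T.src, jW, j, Iso.refl _, hjW, hj, ?_, hr, by simpa using hjq⟩
  · rw [hrD, ← hpre, hr, Set.preimage_compl, compl_compl]
  · rw [hrD, compl_compl]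

lemma IsVal.unique {T : VarOver k X} {v w : IsoPrQuot X} (hv : IsVal T v) (hw : IsVal T w) :
    v = w := by
  obtain ⟨P, C, j, i, hj, hi, hjP, hiP, hr, rfl⟩ := hv
  obtain ⟨P', C', j', i', hj', hi', hjP', hiP', hr', rfl⟩ := hw
  have hPp := P.proper
  have hPp' := P'.proper
  let g : T.src.X ⟶ pullback P.hom P'.hom := pullback.lift j j' (by rw [hjP, hjP'])
  have hg1 : g ≫ pullback.fst _ _ = j := pullback.lift_fst _ _ _
  have hg2 : g ≫ pullback.snd _ _ = j' := pullback.lift_snd _ _ _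
  have : IsImmersion (g ≫ pullback.fst P.hom P'.hom) := by rw [hg1]; infer_instance
  have : IsImmersion g := .of_comp g (pullback.fst P.hom P'.hom)
  have : IsNoetherian (pullback P.hom P'.hom) := by
    have := LocallyOfFiniteType.isLocallyNoetherian (pullback.fst P.hom P'.hom)
    have : CompactSpace ↑(pullback P.hom P'.hom) :=
      QuasiCompact.compactSpace_of_compactSpace (pullback.fst P.hom P'.hom)
    exact ⟨⟩
  have := qc_imm g
  obtain ⟨W, jW, iW, hWr, hjW, hiW, hd, hWg⟩ := exists_dense_closure g
  have hq1 : jW ≫ iW ≫ pullback.fst P.hom P'.hom = j := by rw [← Category.assoc, hWg, hg1]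
  have hq2 : jW ≫ iW ≫ pullback.snd P.hom P'.hom = j' := by rw [← Category.assoc, hWg, hg2]
  let Wp : PropOver X := .ofProper X hWr (iW ≫ pullback.fst _ _ ≫ P.hom) inferInstance
  obtain ⟨D, iD, hDr, hiD, hrD⟩ := exists_closed (Set.range jW)ᶜ
    jW.isOpenEmbedding.isOpen_range.isClosed_compl
  let Dp : PropOver X := Wp.ofClosed hDr iD hiD
  rw [val_step T P C Wp j i hj hi hiP hr jW hjW hd (iW ≫ pullback.fst _ _) (by simp [Wp, PropOver.ofProper])
    hq1 Dp iD hiD rfl hrD,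
    val_step T P' C' Wp j' i' hj' hi' hiP' hr' jW hjW hd (iW ≫ pullback.snd _ _)
    (by simp [Wp, PropOver.ofProper, pullback.condition])
    hq2 Dp iD hiD rfl hrD]

lemma IsVal.iso {T T' : VarOver k X} {v : IsoPrQuot X} (hv : IsVal T v)
    (e : T'.src.X ≅ T.src.X) (he : e.hom ≫ T.hom = T'.hom) : IsVal T' v := by
  obtain ⟨P, C, j, i, hj, hi, hjP, hiP, hr, rfl⟩ := hv
  refine ⟨P, C, e.hom ≫ j, i, inferInstance, hi, by simp [hjP, he], hiP, ?_, rfl⟩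
  rw [← hr, Scheme.Hom.comp_base, TopCat.coe_comp, Set.range_comp,
    Set.range_eq_univ.mpr e.hom.surjective, Set.image_univ]

lemma IsVal.add {Y Z U : VarOver k X} {v : IsoPrQuot X} (hv : IsVal Y v)
    (a : Z.src.X ⟶ Y.src.X) (b : U.src.X ⟶ Y.src.X) (ha : IsClosedImmersion a)
    (hb : IsOpenImmersion b) (haY : a ≫ Y.hom = Z.hom) (hbY : b ≫ Y.hom = U.hom)
    (hab : Set.range b = (Set.range a)ᶜ) :
    ∃ v1 v2, IsVal Z v1 ∧ IsVal U v2 ∧ v = v1 + v2 := by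
  obtain ⟨P, C, j, i, hj, hi, hjP, hiP, hr, rfl⟩ := hv
  -- the complement of `U` in `P`
  have hbj : Set.range (b ≫ j) = j '' (Set.range b) := by
    rw [Scheme.Hom.comp_base, TopCat.coe_comp, Set.range_comp]
  have haj : Set.range (a ≫ j) = j '' (Set.range a) := by
    rw [Scheme.Hom.comp_base, TopCat.coe_comp, Set.range_comp]
  obtain ⟨W, iW, hWr, hiW, hrW⟩ := exists_closed (Set.range (b ≫ j))ᶜ
    (b ≫ j).isOpenEmbedding.isOpen_range.isClosed_compl
  have hrW' : Set.range (b ≫ j) = (Set.range iW)ᶜ := by rw [hrW, compl_compl]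
  let Wp : PropOver X := P.ofClosed hWr iW hiW
  have hinj : Function.Injective j := j.isOpenEmbedding.injective
  obtain ⟨c, hc⟩ := exists_lift_imm iW (a ≫ j) (by
    rw [hrW, hbj, haj, hab]
    rintro _ ⟨y, hy, rfl⟩ ⟨y', hy', h⟩
    exact hy' (hinj h ▸ hy))
  obtain ⟨d, hd⟩ := exists_lift_imm iW i (by
    rw [hrW, hbj]
    rintro y hy ⟨y', hy', rfl⟩
    exact (hr.le ⟨y', rfl⟩) hy)
  have hdc : IsClosedImmersion d := by
    have : IsClosedImmersion (d ≫ iW) := by rw [hd]; exact hi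
    exact .of_comp d iW
  have hcr : Set.range c = (Set.range d)ᶜ := by
    have hiWi : Function.Injective iW := iW.isClosedEmbedding.injective
    ext w
    have hw : iW w ∉ j '' (Set.range b) := by
      rw [← hbj]; exact hrW.le ⟨w, rfl⟩
    constructor
    · rintro ⟨z, rfl⟩ ⟨t, ht⟩
      have h1 : iW (d t) = iW (c z) := by rw [ht]
      rw [← Scheme.Hom.comp_apply, ← Scheme.Hom.comp_apply, hd, hc] at h1
      have : (a ≫ j) z ∈ Set.range j := ⟨a z, by simp⟩
      rw [hr] at this
      exact this ⟨t, h1⟩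
    · intro hwd
      have h1 : iW w ∈ Set.range j := by
        rw [hr]
        rintro ⟨t, ht⟩
        refine hwd ⟨t, hiWi ?_⟩
        rw [← Scheme.Hom.comp_apply, hd, ht]
      obtain ⟨y, hy⟩ := h1
      have h2 : y ∈ Set.range a := by
        by_contra h
        exact hw ⟨y, hab.ge h, hy⟩
      obtain ⟨z, rfl⟩ := h2
      refine ⟨z, hiWi ?_⟩
      rw [← Scheme.Hom.comp_apply, hc, ← hy, Scheme.Hom.comp_apply]
  have hco : IsOpenImmersion c := by
    have h0 : IsImmersion (c ≫ iW) := by rw [hc]; infer_instance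
    have h1 : IsImmersion c := .of_comp c iW
    obtain ⟨O, o, hOr, ho, hro⟩ := exists_open (Y := W) (Set.range c)
      (by rw [hcr]; exact d.isClosedEmbedding.isClosed_range.isOpen_compl)
    obtain ⟨l, hl⟩ := exists_iso_imm o c hro.symm
    rw [← hl]; infer_instance
  refine ⟨IsoPrQuot.mk Wp - IsoPrQuot.mk C, IsoPrQuot.mk P - IsoPrQuot.mk Wp,
    ⟨Wp, C, c, d, hco, hdc, ?_, ?_, hcr, rfl⟩,
    ⟨P, Wp, b ≫ j, iW, inferInstance, hiW, ?_, rfl, ?_, rfl⟩, by abel⟩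
  · change c ≫ iW ≫ P.hom = _
    rw [← Category.assoc, hc, Category.assoc, hjP, haY]
  · change d ≫ iW ≫ P.hom = _
    rw [← Category.assoc, hd, hiP]
  · rw [Category.assoc, hjP, hbY]
  · exact hrW'

lemma isVal_proper (P : PropOver X) : IsVal P.toVarOver (IsoPrQuot.mk P) := by
  obtain ⟨D, iD, hDr, hiD, hrD⟩ := exists_closed (Y := P.src.X) ∅ isClosed_empty
  have h : Set.range (𝟙 P.src.X : P.src.X ⟶ P.src.X) = (Set.range iD)ᶜ := by rw [hrD]; simp
  refine ⟨P, P.ofClosed hDr iD hiD, 𝟙 _, iD, inferInstance, hiD, by simp, rfl, ?_, ?_⟩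
  · exact h
  · have : IsoPrQuot.mk (P.ofClosed hDr iD hiD) = 0 := by
      refine IsoPrQuot.rel (Or.inr (Or.inl ⟨_, ?_, rfl⟩))
      exact Set.range_eq_empty_iff.mp hrD
    rw [this, sub_zero]

end Val

section Affine
open Limits

/-- Projective closure: `Spec B` embeds in a proper scheme over `Spec R`. -/
lemma exists_proj_embed_aux (R A B : Type) [Field R] [CommRing A] [CommRing B] [Algebra R A]
    [Algebra R B] [hftA : Algebra.FiniteType R A] (𝒜 : ℕ → Submodule R A) [GradedAlgebra 𝒜]
    (h0 : ∀ p ∈ 𝒜 0, ∃ r, algebraMap R A r = p)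
    (ev : A →ₐ[R] B) (x0 : A) (hx0 : x0 ∈ 𝒜 1) (hev0 : ev x0 = 1)
    (hgen : Algebra.adjoin R (ev '' (𝒜 1)) = ⊤) :
    ∃ (Q : Scheme.{0}) (p : Q ⟶ Spec (CommRingCat.of R)) (f : Spec (CommRingCat.of B) ⟶ Q),
      IsProper p ∧ IsImmersion f ∧ f ≫ p = Spec.map (CommRingCat.ofHom (algebraMap R B)) := by
  by_cases hB : Subsingleton B
  · have hE : IsEmpty (Spec (CommRingCat.of B)) :=
      inferInstanceAs (IsEmpty (PrimeSpectrum B))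
    have hI : IsImmersion (Spec.map (CommRingCat.ofHom (algebraMap R B))) := by
      have : IsClosedImmersion (Spec.map (CommRingCat.ofHom (algebraMap R B))) :=
        IsClosedImmersion.spec_of_surjective _ (fun b => ⟨0, Subsingleton.elim _ _⟩)
      infer_instance
    exact ⟨_, 𝟙 _, _, inferInstance, hI, Category.comp_id _⟩
  have : Nontrivial B := not_subsingleton_iff_nontrivial.mp hB
  have : Nontrivial A := ev.toRingHom.domain_nontrivial
  let lf : Localization.Away x0 →+* B :=
    Localization.awayLift ev.toRingHom x0 (by simp [hev0])
  have hlf : ∀ p : A, lf (algebraMap A _ p) = ev p := fun p => by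
    simp [lf, Localization.awayLift]
  let ρ : HomogeneousLocalization.Away 𝒜 x0 →+* B := lf.comp (algebraMap _ (Localization.Away x0))
  have hρ0 : ∀ c : 𝒜 0, ρ (HomogeneousLocalization.fromZeroRingHom 𝒜 _ c) = ev c := by
    intro c
    rw [← hlf, ← Localization.mk_one_eq_algebraMap]
    rfl
  have hρs : Function.Surjective ρ := by
    intro b
    have hb : b ∈ Algebra.adjoin R (ev '' (𝒜 1)) := hgen ▸ Algebra.mem_top
    induction hb using Algebra.adjoin_induction with
    | algebraMap r =>
      refine ⟨HomogeneousLocalization.fromZeroRingHom 𝒜 _ (algebraMap R (𝒜 0) r), ?_⟩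
      rw [hρ0]
      exact ev.commutes r
    | add p q _ _ hp hq =>
      obtain ⟨u, hu⟩ := hp
      obtain ⟨v, hv⟩ := hq
      exact ⟨u + v, by simp [hu, hv]⟩
    | mul p q _ _ hp hq =>
      obtain ⟨u, hu⟩ := hp
      obtain ⟨v, hv⟩ := hq
      exact ⟨u * v, by simp [hu, hv]⟩
    | mem x hx =>
      obtain ⟨y, hy, rfl⟩ := hx
      refine ⟨HomogeneousLocalization.Away.mk 𝒜 hx0 1 y (by simpa using hy), ?_⟩
      change lf (Localization.mk y ⟨x0 ^ 1, _⟩) = _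
      have h1 : lf (Localization.mk y (⟨x0 ^ 1, 1, rfl⟩ : Submonoid.powers x0) * algebraMap A _ x0) = ev y := by
        rw [← hlf, ← Localization.mk_one_eq_algebraMap, ← Localization.mk_one_eq_algebraMap,
          Localization.mk_mul]
        congr 1
        rw [Localization.mk_eq_mk_iff, Localization.r_iff_exists]
        exact ⟨1, by simp; ring⟩
      rwa [map_mul, hlf, hev0, mul_one] at h1
  have hft : Algebra.FiniteType (𝒜 0) A := by
    have h1 : ((algebraMap (𝒜 0) A).comp (algebraMap R (𝒜 0))).FiniteType := by
      have : (algebraMap (𝒜 0) A).comp (algebraMap R (𝒜 0)) = algebraMap R A := rfl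
      rw [this]
      exact RingHom.finiteType_algebraMap.mpr hftA
    exact RingHom.finiteType_algebraMap.mp (RingHom.FiniteType.of_comp_finiteType h1)
  let e : R →+* 𝒜 0 := algebraMap R (𝒜 0)
  have hbij : Function.Bijective e := by
    refine ⟨fun r s h => ?_, fun p => ?_⟩
    · exact (algebraMap R A).injective (congrArg Subtype.val h)
    · obtain ⟨r, hr⟩ := h0 p p.2
      exact ⟨r, Subtype.ext hr⟩
  have he : IsIso (Spec.map (CommRingCat.ofHom e)) := by
    have : IsIso (CommRingCat.ofHom e) := 
      (ConcreteCategory.isIso_iff_bijective (CommRingCat.ofHom e)).mpr hbij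
    infer_instance
  have hcl : IsClosedImmersion (Spec.map (CommRingCat.ofHom ρ)) :=
    IsClosedImmersion.spec_of_surjective _ hρs
  refine ⟨Proj 𝒜, Proj.toSpecZero 𝒜 ≫ Spec.map (CommRingCat.ofHom e),
    Spec.map (CommRingCat.ofHom ρ) ≫ Proj.awayι 𝒜 x0 hx0 one_pos, inferInstance, inferInstance, ?_⟩
  rw [Category.assoc, Proj.awayι_toSpecZero_assoc, ← Spec.map_comp, ← Spec.map_comp]
  congr 1
  ext r
  change ρ (HomogeneousLocalization.fromZeroRingHom 𝒜 _ (e r)) = _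
  rw [hρ0]
  exact ev.commutes r

attribute [local instance] MvPolynomial.gradedAlgebra

lemma exists_proj_embed (R B : Type) [Field R] [CommRing B] [Algebra R B]
    [Algebra.FiniteType R B] :
    ∃ (Q : Scheme.{0}) (p : Q ⟶ Spec (CommRingCat.of R)) (f : Spec (CommRingCat.of B) ⟶ Q),
      IsProper p ∧ IsImmersion f ∧ f ≫ p = Spec.map (CommRingCat.ofHom (algebraMap R B)) := by
  obtain ⟨n, s, hs⟩ := Algebra.FiniteType.iff_quotient_mvPolynomial''.mp
    (inferInstance : Algebra.FiniteType R B)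
  let a : Option (Fin n) → B := fun o => o.elim 1 (fun i => s (MvPolynomial.X i))
  refine exists_proj_embed_aux R (MvPolynomial (Option (Fin n)) R) B
    (MvPolynomial.homogeneousSubmodule (Option (Fin n)) R) ?_ (MvPolynomial.aeval a)
    (MvPolynomial.X none) (MvPolynomial.isHomogeneous_X _ _)
    (by rw [MvPolynomial.aeval_X]; rfl) ?_
  · intro p hp
    rw [MvPolynomial.homogeneousSubmodule_zero, Submodule.mem_one] at hp
    exact hp
  · rw [eq_top_iff]
    intro b _
    obtain ⟨p, rfl⟩ := hs b
    induction p using MvPolynomial.induction_on with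
    | C r =>
      have : s (MvPolynomial.C r) = algebraMap R B r := s.commutes r
      rw [this]; exact Subalgebra.algebraMap_mem _ r
    | add p q hp hq => rw [map_add]; exact add_mem (hp trivial) (hq trivial)
    | mul_X p i hp =>
      rw [map_mul]
      refine mul_mem (hp trivial) (Algebra.subset_adjoin ⟨MvPolynomial.X (some i),
        MvPolynomial.isHomogeneous_X _ _, ?_⟩)
      rw [MvPolynomial.aeval_X]; rfl

end Affine
section Affine2
open Limits
attribute [local instance] Var.isNoeth
variable {X : Var k}

lemma exists_affine_embed (Y : Var k) [IsAffine Y.X] :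
    ∃ (Q : Scheme.{0}) (p : Q ⟶ Spec (CommRingCat.of k)) (f : Y.X ⟶ Q),
      IsProper p ∧ IsImmersion f ∧ f ≫ p = Y.str := by
  have hlf := Y.locallyOfFiniteType
  let B := Y.X.presheaf.obj (.op ⊤)
  let s : Y.X ⟶ Spec (CommRingCat.of k) := Y.str
  have hs : LocallyOfFiniteType s := hlf
  obtain ⟨φ, hφ⟩ := Spec.map_surjective (Y.X.isoSpec.inv ≫ s)
  have h1 : LocallyOfFiniteType (Spec.map φ) := by rw [hφ]; infer_instance
  have h2 : φ.hom.FiniteType := (HasRingHomProperty.Spec_iff (P := @LocallyOfFiniteType)).mp h1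
  let _ : Algebra k B := φ.hom.toAlgebra
  have h3 : Algebra.FiniteType k B := h2
  obtain ⟨Q, p, f, hp, hf, hfp⟩ := exists_proj_embed k B
  refine ⟨Q, p, Y.X.isoSpec.hom ≫ f, hp, inferInstance, ?_⟩
  have h4 : f ≫ p = Spec.map φ := hfp
  rw [Category.assoc, h4, hφ]
  simp [s]

lemma isVal_affine (Y : VarOver k X) [IsAffine Y.src.X] : ∃ v, IsVal Y v := by
  obtain ⟨Q, p, f, hp, hf, hfp⟩ := exists_affine_embed Y.src
  let s : X.X ⟶ Spec (CommRingCat.of k) := X.str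
  have hs : Y.hom ≫ s = Y.src.str := Y.w
  let g : Y.src.X ⟶ pullback p s := pullback.lift f Y.hom (by rw [hfp, hs])
  have hg1 : g ≫ pullback.fst _ _ = f := pullback.lift_fst _ _ _
  have hg2 : g ≫ pullback.snd _ _ = Y.hom := pullback.lift_snd _ _ _
  have : IsImmersion (g ≫ pullback.fst p s) := by rw [hg1]; infer_instance
  have : IsImmersion g := .of_comp g (pullback.fst p s)
  have : IsNoetherian (pullback p s) := by
    have := LocallyOfFiniteType.isLocallyNoetherian (pullback.snd p s)
    have : CompactSpace ↑(pullback p s) :=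
      QuasiCompact.compactSpace_of_compactSpace (pullback.snd p s)
    exact ⟨⟩
  have := qc_imm g
  obtain ⟨W, jW, iW, hWr, hjW, hiW, hd, hWg⟩ := exists_dense_closure g
  have hq2 : jW ≫ iW ≫ pullback.snd p s = Y.hom := by rw [← Category.assoc, hWg, hg2]
  obtain ⟨D, iD, hDr, hiD, hrD⟩ := exists_closed (Set.range jW)ᶜ
    jW.isOpenEmbedding.isOpen_range.isClosed_compl
  have hrD' : Set.range jW = (Set.range iD)ᶜ := by rw [hrD, compl_compl]
  let Wp : PropOver X := .ofProper X hWr (iW ≫ pullback.snd p s) inferInstance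
  exact ⟨_, Wp, Wp.ofClosed hDr iD hiD, jW, iD, hjW, hiD, hq2, rfl, hrD', rfl⟩

end Affine2
section Class
open Limits
attribute [local instance] Var.isNoeth
variable {X : Var k}

/-- `v` is the value at the locally closed subset `S` of `Y`. -/
def HasVal (Y : VarOver k X) (S : Set Y.src.X) (v : IsoPrQuot X) : Prop :=
  ∃ (T : VarOver k X) (f : T.src.X ⟶ Y.src.X), IsImmersion f ∧ f ≫ Y.hom = T.hom ∧
    Set.range f = S ∧ IsVal T v

lemma HasVal.unique {Y : VarOver k X} {S : Set Y.src.X} {v w : IsoPrQuot X}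
    (hv : HasVal Y S v) (hw : HasVal Y S w) : v = w := by
  obtain ⟨T, f, hf, hfY, hr, hv⟩ := hv
  obtain ⟨T', f', hf', hfY', hr', hw⟩ := hw
  obtain ⟨l, hl⟩ := exists_iso_imm f f' (hr'.trans hr.symm)
  exact (hv.iso l (by rw [← hfY, ← Category.assoc, hl, hfY'])).unique hw

/-- Sets having a value. -/
def Good (Y : VarOver k X) (S : Set Y.src.X) : Prop := ∃ v, HasVal Y S v

open Classical in
/-- The value of a set (zero if there is none). -/
noncomputable def mval (Y : VarOver k X) (S : Set Y.src.X) : IsoPrQuot X :=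
  if h : Good Y S then h.choose else 0

lemma mval_spec {Y : VarOver k X} {S : Set Y.src.X} (h : Good Y S) : HasVal Y S (mval Y S) := by
  rw [mval, dif_pos h]; exact h.choose_spec

lemma HasVal.mval_eq {Y : VarOver k X} {S : Set Y.src.X} {v : IsoPrQuot X} (h : HasVal Y S v) :
    mval Y S = v := (mval_spec ⟨v, h⟩).unique h

lemma range_comp' {A B C : Scheme.{0}} (f : A ⟶ B) (g : B ⟶ C) :
    Set.range (f ≫ g) = g '' Set.range f := by
  rw [Scheme.Hom.comp_base, TopCat.coe_comp, Set.range_comp]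

lemma isCont_mval (Y : VarOver k X) : IsCont (mval Y) (Good Y) := by
  intro S C hS hC
  have h := mval_spec hS
  obtain ⟨T, f, hf, hfY, rfl, hv⟩ := h
  have hfC : IsClosed (f ⁻¹' C) := hC.preimage f.continuous
  obtain ⟨Z, a, hZ, ha, hra⟩ := exists_closed (f ⁻¹' C) hfC
  obtain ⟨U, b, hU, hb, hrb⟩ := exists_open (Y := T.src.X) (f ⁻¹' C)ᶜ hfC.isOpen_compl
  have hab : Set.range b = (Set.range a)ᶜ := by rw [hra, hrb]
  have hrfa : Set.range (a ≫ f) = Set.range f ∩ C := by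
    rw [range_comp', hra, Set.image_preimage_eq_range_inter]
  have hrfb : Set.range (b ≫ f) = Set.range f \ C := by
    rw [range_comp', hrb, ← Set.preimage_compl, Set.image_preimage_eq_range_inter]; rfl
  have h1 : (a ≫ f) ≫ Y.hom = a ≫ T.hom := by rw [Category.assoc, hfY]
  have h2 : (b ≫ f) ≫ Y.hom = b ≫ T.hom := by rw [Category.assoc, hfY]
  have i1 : IsImmersion (a ≫ f) := inferInstance
  have i2 : IsImmersion (b ≫ f) := inferInstance
  obtain ⟨v1, v2, hv1, hv2, hsum⟩ := hv.add (Z := T.ofImm hZ a inferInstance)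
    (U := T.ofImm hU b inferInstance) a b ha hb rfl rfl hab
  have H1 : HasVal Y (Set.range f ∩ C) v1 := ⟨_, a ≫ f, i1, h1, hrfa, hv1⟩
  have H2 : HasVal Y (Set.range f \ C) v2 := ⟨_, b ≫ f, i2, h2, hrfb, hv2⟩
  exact ⟨⟨_, H1⟩, ⟨_, H2⟩, by rw [H1.mval_eq, H2.mval_eq, hsum]⟩

lemma HasVal.image {Y Z : VarOver k X} (i : Z.src.X ⟶ Y.src.X) [IsImmersion i]
    (hi : i ≫ Y.hom = Z.hom) {S : Set Z.src.X} {v : IsoPrQuot X} (h : HasVal Z S v) :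
    HasVal Y (i '' S) v := by
  obtain ⟨T, f, hf, hfZ, rfl, hv⟩ := h
  exact ⟨T, f ≫ i, inferInstance, by rw [Category.assoc, hi, hfZ], range_comp' _ _, hv⟩

lemma HasVal.preimage {Y Z : VarOver k X} (i : Z.src.X ⟶ Y.src.X) [IsImmersion i]
    (hi : i ≫ Y.hom = Z.hom) {S : Set Y.src.X} {v : IsoPrQuot X} (h : HasVal Y S v)
    (hS : S ⊆ Set.range i) : HasVal Z (i ⁻¹' S) v := by
  obtain ⟨T, f, hf, hfZ, rfl, hv⟩ := h
  obtain ⟨l, hl⟩ := exists_lift_imm i f hS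
  have : IsImmersion (l ≫ i) := by rw [hl]; exact hf
  have hl' : IsImmersion l := .of_comp l i
  refine ⟨T, l, hl', by rw [← hi, ← Category.assoc, hl, hfZ], ?_, hv⟩
  rw [← hl, range_comp', Set.preimage_image_eq _ i.isEmbedding.injective]

lemma good_image_iff {Y Z : VarOver k X} (i : Z.src.X ⟶ Y.src.X) [IsImmersion i]
    (hi : i ≫ Y.hom = Z.hom) (S : Set Z.src.X) : Good Y (i '' S) ↔ Good Z S := by
  constructor
  · rintro ⟨v, h⟩
    refine ⟨v, ?_⟩
    have := h.preimage i hi (Set.image_subset_range _ _)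
    rwa [Set.preimage_image_eq _ i.isEmbedding.injective] at this
  · rintro ⟨v, h⟩
    exact ⟨v, h.image i hi⟩

lemma mval_image {Y Z : VarOver k X} (i : Z.src.X ⟶ Y.src.X) [IsImmersion i]
    (hi : i ≫ Y.hom = Z.hom) (S : Set Z.src.X) : mval Y (i '' S) = mval Z S := by
  by_cases h : Good Z S
  · exact ((mval_spec h).image i hi).mval_eq
  · have h' : ¬ Good Y (i '' S) := by rwa [good_image_iff i hi]
    rw [mval, dif_neg h', mval, dif_neg h]

lemma ccont_image {Y Z : VarOver k X} (i : Z.src.X ⟶ Y.src.X) [IsImmersion i]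
    (hi : i ≫ Y.hom = Z.hom) (L : List (Set Y.src.X)) (B : Set Z.src.X) :
    ccont (mval Z) (L.map (fun U => i ⁻¹' U)) B = ccont (mval Y) L (i '' B) := by
  induction L generalizing B with
  | nil => rfl
  | cons U L ih =>
    simp only [List.map_cons, ccont]
    rw [ih, ← mval_image i hi, Set.image_inter_preimage]
    congr 2
    ext y
    constructor
    · rintro ⟨z, ⟨hz, hzU⟩, rfl⟩
      exact ⟨⟨z, hz, rfl⟩, hzU⟩
    · rintro ⟨⟨z, hz, rfl⟩, hzU⟩
      exact ⟨z, ⟨hz, hzU⟩, rfl⟩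

lemma good_affine (Y : VarOver k X) (U : Y.src.X.Opens) (hU : IsAffineOpen U) :
    Good Y (U : Set Y.src.X) := by
  have hr : Set.range U.ι = (U : Set Y.src.X) := by simp
  have h1 : IsReduced U.toScheme := inferInstance
  have h2 : IsImmersion U.ι := inferInstance
  have h3 : IsAffine (Y.ofImm h1 U.ι h2).src.X := hU
  obtain ⟨v, hv⟩ := isVal_affine (Y.ofImm h1 U.ι h2)
  exact ⟨v, _, U.ι, h2, rfl, hr, hv⟩

lemma good_empty (Y : VarOver k X) : Good Y ∅ := by
  have := good_affine Y ⊥ (isAffineOpen_bot _)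
  simpa using this

lemma exists_cover (Y : VarOver k X) : ∃ L : List (Set Y.src.X), (∀ U ∈ L, IsOpen U) ∧
    (∀ U ∈ L, Good Y U) ∧ ∀ x, ∃ U ∈ L, x ∈ U := by
  have h := Y.src.X.isBasis_affineOpens
  obtain ⟨t, ht⟩ := (isCompact_univ (X := Y.src.X)).elim_finite_subcover
    (fun U : Y.src.X.affineOpens => ((U : Y.src.X.Opens) : Set Y.src.X))
    (fun U => U.1.isOpen) (by
      intro x _
      obtain ⟨U, hU, hxU, -⟩ := TopologicalSpace.Opens.isBasis_iff_nbhd.mp h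
        (show x ∈ (⊤ : Y.src.X.Opens) from trivial)
      exact Set.mem_iUnion.mpr ⟨⟨U, hU⟩, hxU⟩)
  refine ⟨t.toList.map (fun U : Y.src.X.affineOpens => ((U : Y.src.X.Opens) : Set Y.src.X)), ?_, ?_, ?_⟩
  · intro U hU
    obtain ⟨V, -, rfl⟩ := List.mem_map.mp hU
    exact V.1.isOpen
  · intro U hU
    obtain ⟨V, -, rfl⟩ := List.mem_map.mp hU
    exact good_affine Y V.1 V.2
  · intro x
    obtain ⟨V, hV, hx⟩ := Set.mem_iUnion₂.mp (ht (Set.mem_univ x))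
    exact ⟨_, List.mem_map.mpr ⟨V, by simpa using hV, rfl⟩, hx⟩

/-- a chosen good open cover -/
noncomputable def cov (Y : VarOver k X) : List (Set Y.src.X) := (exists_cover Y).choose
lemma cov_open (Y : VarOver k X) : ∀ U ∈ cov Y, IsOpen U := (exists_cover Y).choose_spec.1
lemma cov_good (Y : VarOver k X) : ∀ U ∈ cov Y, Good Y U := (exists_cover Y).choose_spec.2.1
lemma cov_cover (Y : VarOver k X) : ∀ x, ∃ U ∈ cov Y, x ∈ U := (exists_cover Y).choose_spec.2.2

/-- The class in `Iso^pr/(ac)` of an arbitrary variety over `X`. -/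
noncomputable def cls (Y : VarOver k X) : IsoPrQuot X := ccont (mval Y) (cov Y) Set.univ

lemma cls_imm {Y Z : VarOver k X} (i : Z.src.X ⟶ Y.src.X) [IsImmersion i]
    (hi : i ≫ Y.hom = Z.hom) (hg : ∀ U, Good Y U → Good Y (U ∩ Set.range i)) :
    cls Z = ccont (mval Y) (cov Y) (Set.range i) := by
  rw [← Set.image_univ, ← ccont_image i hi]
  refine ccont_eq (isCont_mval Z) (good_empty Z) _ _ (cov_open Z) ?_ _ ?_ ?_ ?_ ?_
  · intro U hU
    obtain ⟨V, hV, rfl⟩ := List.mem_map.mp hU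
    exact (cov_open Y V hV).preimage i.continuous
  · intro U hU
    rw [Set.univ_inter]; exact cov_good Z U hU
  · intro U hU
    obtain ⟨V, hV, rfl⟩ := List.mem_map.mp hU
    rw [Set.univ_inter, ← good_image_iff i hi, Set.image_preimage_eq_inter_range]
    exact hg V (cov_good Y V hV)
  · exact fun x _ => cov_cover Z x
  · intro x _
    obtain ⟨V, hV, hx⟩ := cov_cover Y (i x)
    exact ⟨_, List.mem_map.mpr ⟨V, hV, rfl⟩, hx⟩

lemma cls_closed {Y Z : VarOver k X} (i : Z.src.X ⟶ Y.src.X) [IsClosedImmersion i]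
    (hi : i ≫ Y.hom = Z.hom) : cls Z = ccont (mval Y) (cov Y) (Set.range i) :=
  cls_imm i hi (fun U hU => (isCont_mval Y U _ hU i.isClosedEmbedding.isClosed_range).1)

lemma cls_open {Y Z : VarOver k X} (i : Z.src.X ⟶ Y.src.X) [IsOpenImmersion i]
    (hi : i ≫ Y.hom = Z.hom) : cls Z = ccont (mval Y) (cov Y) (Set.range i) :=
  cls_imm i hi (fun U hU => ((isCont_mval Y).openInter hU i.isOpenEmbedding.isOpen_range).1)

lemma cls_iso {Y Z : VarOver k X} (e : Y.src.X ≅ Z.src.X) (he : e.hom ≫ Z.hom = Y.hom) :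
    cls Y = cls Z := by
  rw [cls_open e.hom he, Set.range_eq_univ.mpr e.hom.surjective]; rfl

lemma cls_add {Y Z U : VarOver k X} (i : Z.src.X ⟶ Y.src.X) (j : U.src.X ⟶ Y.src.X)
    [IsClosedImmersion i] [IsOpenImmersion j] (hi : i ≫ Y.hom = Z.hom) (hj : j ≫ Y.hom = U.hom)
    (hr : Set.range j = (Set.range i)ᶜ) : cls Y = cls Z + cls U := by
  rw [cls_closed i hi, cls_open j hj, cls, ccont_split (isCont_mval Y) _ (cov_open Y) Set.univ
    (Set.range i) (fun V hV => by rw [Set.univ_inter]; exact cov_good Y V hV)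
    i.isClosedEmbedding.isClosed_range, hr, Set.univ_inter, Set.compl_eq_univ_sdiff]

lemma cls_proper (P : PropOver X) : cls P.toVarOver = IsoPrQuot.mk P := by
  have hr : Set.range (𝟙 P.src.X : P.src.X ⟶ P.src.X) = Set.univ := by simp
  have h : HasVal P.toVarOver Set.univ (IsoPrQuot.mk P) :=
    ⟨P.toVarOver, 𝟙 _, inferInstance, by simp, hr, isVal_proper P⟩
  rw [cls, ccont_good (isCont_mval _) _ (cov_open _) _ ⟨_, h⟩ (fun x _ => cov_cover _ x), h.mval_eq]

lemma K0Var.rel {a : FreeAbelianGroup (VarOver k X)} (h : a ∈ isoRel X ∪ addRel X) :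
    (QuotientAddGroup.mk a : FreeAbelianGroup (VarOver k X) ⧸
      AddSubgroup.closure (isoRel X ∪ addRel X)) = 0 :=
  (QuotientAddGroup.eq_zero_iff _).mpr (AddSubgroup.subset_closure h)

lemma K0Var.iso {Y Z : VarOver k X} (e : Y.src.X ≅ Z.src.X) (he : e.hom ≫ Z.hom = Y.hom) :
    K0Var.mk Y = K0Var.mk Z := by
  rw [← sub_eq_zero]
  exact K0Var.rel (Or.inl ⟨Y, Z, e, he, rfl⟩)

lemma K0Var.add {Y Z U : VarOver k X} (i : Z.src.X ⟶ Y.src.X) (j : U.src.X ⟶ Y.src.X)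
    (h1 : IsClosedImmersion i) (h2 : IsOpenImmersion j) (hi : i ≫ Y.hom = Z.hom)
    (hj : j ≫ Y.hom = U.hom)
    (hr : Set.range j = (Set.range i)ᶜ) : K0Var.mk Y = K0Var.mk Z + K0Var.mk U := by
  have : K0Var.mk Y - K0Var.mk Z - K0Var.mk U = 0 :=
    K0Var.rel (Or.inr ⟨Y, Z, U, i, j, h1, h2, hi, hj, hr, rfl⟩)
  rw [sub_sub, sub_eq_zero] at this
  exact this

lemma K0Var.empty {Y : VarOver k X} (h : IsEmpty Y.src.X) : K0Var.mk Y = 0 := by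
  have hr : Set.range (𝟙 Y.src.X : Y.src.X ⟶ Y.src.X) =
    (Set.range (𝟙 Y.src.X : Y.src.X ⟶ Y.src.X))ᶜ := by
    ext x; exact h.elim x
  have := K0Var.add (Y := Y) (Z := Y) (U := Y) (𝟙 _) (𝟙 _) inferInstance inferInstance
    (by simp) (by simp) hr
  simpa using this

/-- the canonical homomorphism exists -/
lemma exists_phi (X : Var k) : ∃ φ : IsoPrQuot X →+ K0Var X,
    ∀ P : PropOver X, φ (IsoPrQuot.mk P) = K0Var.mk P.toVarOver := by
  let F : FreeAbelianGroup (PropOver X) →+ K0Var X :=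
    FreeAbelianGroup.lift (fun P : PropOver X => K0Var.mk P.toVarOver)
  have hF : ∀ P, F (FreeAbelianGroup.of P) = K0Var.mk P.toVarOver :=
    fun P => FreeAbelianGroup.lift_apply_of _ _
  have hk : AddSubgroup.closure (isoRelPr X ∪ acRel X) ≤ F.ker := by
    rw [AddSubgroup.closure_le]
    rintro a (⟨Y, Z, e, he, rfl⟩ | ⟨E, hE, rfl⟩ | ⟨X', Xt, Z', Zt, q, i, it, hq, hi, hit, hqX,
      hiX, hitX, hr, ⟨U, V, ju, jv, e, hju, hjv, hru, hrv, hje⟩, rfl⟩)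
    · simp only [SetLike.mem_coe, AddMonoidHom.mem_ker, map_sub, hF]
      rw [K0Var.iso e he, sub_self]
    · simp only [SetLike.mem_coe, AddMonoidHom.mem_ker, hF]
      exact K0Var.empty hE
    · simp only [SetLike.mem_coe, AddMonoidHom.mem_ker, map_sub, hF]
      have e1 := K0Var.add (Y := Xt.toVarOver) (Z := Zt.toVarOver)
        (U := Xt.toVarOver.ofImm U.reduced ju inferInstance) it ju hit hju hitX rfl hru
      have e2 := K0Var.add (Y := X'.toVarOver) (Z := Z'.toVarOver)
        (U := X'.toVarOver.ofImm V.reduced jv inferInstance) i jv hi hjv hiX rfl hrv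
      have h3 : e.hom ≫ jv ≫ X'.hom = ju ≫ Xt.hom := by
        rw [← Category.assoc, ← hje, Category.assoc, hqX]
      have e3 := K0Var.iso (Y := Xt.toVarOver.ofImm U.reduced ju inferInstance)
        (Z := X'.toVarOver.ofImm V.reduced jv inferInstance) e h3
      rw [e1, e2, e3]; abel
  exact ⟨QuotientAddGroup.lift _ F hk, fun P => hF P⟩

/-- the inverse homomorphism exists -/
lemma exists_psi (X : Var k) : ∃ ψ : K0Var X →+ IsoPrQuot X,
    ∀ Y : VarOver k X, ψ (K0Var.mk Y) = cls Y := by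
  let F : FreeAbelianGroup (VarOver k X) →+ IsoPrQuot X := FreeAbelianGroup.lift cls
  have hF : ∀ P, F (FreeAbelianGroup.of P) = cls P := fun P => FreeAbelianGroup.lift_apply_of _ _
  have hk : AddSubgroup.closure (isoRel X ∪ addRel X) ≤ F.ker := by
    rw [AddSubgroup.closure_le]
    rintro a (⟨Y, Z, e, he, rfl⟩ | ⟨Y, Z, U, i, j, hi, hj, hiY, hjY, hr, rfl⟩)
    · simp only [SetLike.mem_coe, AddMonoidHom.mem_ker, map_sub, hF]
      rw [cls_iso e he, sub_self]
    · simp only [SetLike.mem_coe, AddMonoidHom.mem_ker, map_sub, hF]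
      rw [cls_add i j hiY hjY hr]; abel
  exact ⟨QuotientAddGroup.lift _ F hk, fun P => hF P⟩

lemma phi_isVal {φ : IsoPrQuot X →+ K0Var X}
    (hφ : ∀ P : PropOver X, φ (IsoPrQuot.mk P) = K0Var.mk P.toVarOver)
    {T : VarOver k X} {v : IsoPrQuot X} (h : IsVal T v) : φ v = K0Var.mk T := by
  obtain ⟨P, C, j, i, hj, hi, hjP, hiP, hr, rfl⟩ := h
  rw [map_sub, hφ, hφ, K0Var.add (Y := P.toVarOver) i j hi hj hiP hjP hr]; abel

lemma phi_mval {φ : IsoPrQuot X →+ K0Var X}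
    (hφ : ∀ P : PropOver X, φ (IsoPrQuot.mk P) = K0Var.mk P.toVarOver)
    {Y T : VarOver k X} (f : T.src.X ⟶ Y.src.X) [IsImmersion f]
    (hf : f ≫ Y.hom = T.hom) (h : Good Y (Set.range f)) :
    φ (mval Y (Set.range f)) = K0Var.mk T := by
  obtain ⟨T', f', hf', hfY', hr', hw⟩ := mval_spec h
  obtain ⟨l, hl⟩ := exists_iso_imm f f' hr'
  rw [phi_isVal hφ hw]
  exact K0Var.iso l (by rw [← hf, ← Category.assoc, hl, hfY'])

lemma phi_ccont {φ : IsoPrQuot X →+ K0Var X}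
    (hφ : ∀ P : PropOver X, φ (IsoPrQuot.mk P) = K0Var.mk P.toVarOver)
    {Y : VarOver k X} (L : List (Set Y.src.X)) (hL : ∀ U ∈ L, IsOpen U)
    (T : VarOver k X) (f : T.src.X ⟶ Y.src.X) [IsImmersion f] (hf : f ≫ Y.hom = T.hom)
    (hg : ∀ U ∈ L, Good Y (Set.range f ∩ U)) (hc : ∀ x ∈ Set.range f, ∃ U ∈ L, x ∈ U) :
    φ (ccont (mval Y) L (Set.range f)) = K0Var.mk T := by
  induction L generalizing T with
  | nil =>
    rw [K0Var.empty ⟨fun x => by simpa using hc (f x) ⟨x, rfl⟩⟩]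
    simp [ccont]
  | cons U L ih =>
    have hU := hL U (by simp)
    have hfU : IsOpen (f ⁻¹' U) := hU.preimage f.continuous
    obtain ⟨Z, a, hZ, ha, hra⟩ := exists_closed (f ⁻¹' U)ᶜ hfU.isClosed_compl
    obtain ⟨V, b, hV, hb, hrb⟩ := exists_open (Y := T.src.X) (f ⁻¹' U) hfU
    have hab : Set.range b = (Set.range a)ᶜ := by rw [hra, hrb, compl_compl]
    have hrfb : Set.range (b ≫ f) = Set.range f ∩ U := by
      rw [range_comp', hrb, Set.image_preimage_eq_range_inter]
    have hrfa : Set.range (a ≫ f) = Set.range f \ U := by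
      rw [range_comp', hra, ← Set.preimage_compl, Set.image_preimage_eq_range_inter]; rfl
    have h1 : (a ≫ f) ≫ Y.hom = a ≫ T.hom := by rw [Category.assoc, hf]
    have h2 : (b ≫ f) ≫ Y.hom = b ≫ T.hom := by rw [Category.assoc, hf]
    have i1 : IsImmersion (a ≫ f) := inferInstance
    have i2 : IsImmersion (b ≫ f) := inferInstance
    have e1 : φ (mval Y (Set.range f ∩ U)) = K0Var.mk (T.ofImm hV b inferInstance) := by
      have := @phi_mval _ _ _ X φ hφ Y (T.ofImm hV b inferInstance) (b ≫ f) i2 h2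
        (by have := hg U (by simp); rw [← hrfb] at this; exact this)
      rw [← this, ← hrfb]; rfl
    have e2 : φ (ccont (mval Y) L (Set.range f \ U)) = K0Var.mk (T.ofImm hZ a inferInstance) := by
      rw [← hrfa]
      refine @ih (fun V hV => hL V (by simp [hV])) (T.ofImm hZ a inferInstance) (a ≫ f) i1 h1 ?_ ?_
      · intro W hW
        have h3 := ((isCont_mval Y).openInter (hg W (by simp [hW])) hU).2.1
        have h4 : Set.range (a ≫ f) ∩ W = (Set.range f ∩ W) \ U := by
          rw [hrfa]; ext; simp; tauto
        rw [← h4] at h3; exact h3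
      · intro x hx
        have hx' : x ∈ Set.range f \ U := by rw [← hrfa]; exact hx
        obtain ⟨W, hW, hxW⟩ := hc x hx'.1
        simp only [List.mem_cons] at hW
        rcases hW with rfl | hW
        · exact absurd hxW hx'.2
        · exact ⟨W, hW, hxW⟩
    simp only [ccont, map_add]
    rw [e1, e2, add_comm]
    exact (K0Var.add (Y := T) a b ha hb rfl rfl hab).symm

lemma phi_cls {φ : IsoPrQuot X →+ K0Var X}
    (hφ : ∀ P : PropOver X, φ (IsoPrQuot.mk P) = K0Var.mk P.toVarOver)
    (Y : VarOver k X) : φ (cls Y) = K0Var.mk Y := by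
  have hr : Set.range (𝟙 Y.src.X : Y.src.X ⟶ Y.src.X) = Set.univ := by simp
  have := phi_ccont hφ (cov Y) (cov_open Y) Y (𝟙 _) (by simp)
    (fun U hU => by rw [hr, Set.univ_inter]; exact cov_good Y U hU) (fun x _ => cov_cover Y x)
  rwa [hr] at this

end Class

/-- the canonical group homomorphism `Iso^pr(var/X) → K₀(var/X)`,
`[X' → X] ↦ [X' → X]`, kills the acyclicity relations (ac) and induces a group
isomorphism `Iso^pr(var/X)/(ac) ≅ K₀(var/X)`: there is a (necessarily unique) group
homomorphism on the quotient sending the class of each proper `[X' → X]` to its class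
in `K₀(var/X)`, and it is bijective. -/
theorem stmt_0 (X : Var k) :
    ∃ φ : IsoPrQuot X →+ K0Var X,
      (∀ P : PropOver X, φ (IsoPrQuot.mk P) = K0Var.mk P.toVarOver) ∧
      Function.Bijective φ := by

  obtain ⟨φ, hφ⟩ := exists_phi X
  obtain ⟨ψ, hψ⟩ := exists_psi X
  refine ⟨φ, hφ, ?_, ?_⟩
  · have h : ∀ a, ψ (φ a) = a := by
      intro a
      induction a using QuotientAddGroup.induction_on with
      | H z =>
        induction z using FreeAbelianGroup.induction_on with
        | zero =>
          change ψ (φ 0) = 0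
          rw [map_zero, map_zero]
        | of P =>
          change ψ (φ (IsoPrQuot.mk P)) = IsoPrQuot.mk P
          rw [hφ, hψ, cls_proper]
        | neg P hP =>
          change ψ (φ (-IsoPrQuot.mk P)) = -IsoPrQuot.mk P
          rw [map_neg, map_neg, hφ, hψ, cls_proper]
        | add x y hx hy =>
          exact (congrArg ψ (φ.map_add _ _)).trans ((ψ.map_add _ _).trans (congrArg₂ _ hx hy))
    exact Function.LeftInverse.injective h
  · intro b
    induction b using QuotientAddGroup.induction_on with
    | H z =>
      induction z using FreeAbelianGroup.induction_on with
      | zero => exact ⟨0, map_zero φ⟩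
      | of Y => exact ⟨cls Y, phi_cls hφ Y⟩
      | neg Y hY => exact ⟨-cls Y, by rw [map_neg, phi_cls hφ Y]; rfl⟩
      | add x y hx hy =>
        obtain ⟨u, hu⟩ := hx
        obtain ⟨v, hv⟩ := hy
        exact ⟨u + v, by rw [map_add, hu, hv]; rfl⟩
end

section
/- Let f : X' → X be any morphism of k-varieties. Call a compactification of f an open immersion X' ⊆ X̄' into a k-variety X̄' together with a proper morphism X̄' → X whose restriction to X' is f. Then: (i) for any two compactifications (X̄'_1) and (X̄'_2) of f, the difference classes [X̄'_1 → X] − [X̄'_1∖X' → X] and [X̄'_2 → X] − [X̄'_2∖X' → X] agree in the quotient Iso^pr(var/X)/(ac); (ii) writing φ([f : X' → X]) for this common class, for every closed subvariety Z ⊆ X' one has the additivity φ([X' → X]) = φ([Z → X]) + φ([X'∖Z → X]) in Iso^pr(var/X)/(ac), where Z → X and X'∖Z → X are the restrictions of f. -/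
open AlgebraicGeometry CategoryTheory

variable (k : Type) [Field k] [CharZero k]

variable {k}

/-- A compactification of a morphism `f : X' → X` of `k`-varieties: an open immersion
`X' ⊆ X̄'` together with a proper morphism `X̄' → X` restricting to `f`, and the
boundary `X̄'∖X'` (the closed complement with its reduced structure). -/
structure Compactification {X : Var k} (f : VarOver k X) where
  /-- the compactification `X̄'` -/
  cpt : Var k
  /-- the open immersion `X' ⊆ X̄'` -/
  j : f.src.X ⟶ cpt.X
  openImm : IsOpenImmersion j
  /-- the proper morphism `X̄' → X` -/
  p : cpt.X ⟶ X.X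
  proper : IsProper p
  wp : p ≫ X.str = cpt.str
  hj : j ≫ p = f.hom
  /-- the boundary `X̄'∖X'` -/
  bd : Var k
  /-- the closed immersion `X̄'∖X' → X̄'` -/
  b : bd.X ⟶ cpt.X
  closedImm : IsClosedImmersion b
  wb : b ≫ cpt.str = bd.str
  compl : Set.range b.base = (Set.range j.base)ᶜ

variable {X : Var k} {f : VarOver k X}

/-- `[X̄' → X]` as a proper variety over `X`. -/
def Compactification.total (c : Compactification f) : PropOver X where
  src := c.cpt
  hom := c.p
  w := c.wp
  proper := c.proper

/-- `[X̄'∖X' → X]` as a proper variety over `X`. -/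
def Compactification.boundary (c : Compactification f) : PropOver X where
  src := c.bd
  hom := c.b ≫ c.p
  w := by rw [Category.assoc, c.wp, c.wb]
  proper := by
    haveI := c.closedImm
    exact MorphismProperty.comp_mem _ _ _ inferInstance c.proper

/-- The difference class `[X̄' → X] − [X̄'∖X' → X] ∈ Iso^pr(var/X)/(ac)` associated to a
compactification of `f : X' → X`. -/
def Compactification.diffClass (c : Compactification f) : IsoPrQuot X :=
  IsoPrQuot.mk c.total - IsoPrQuot.mk c.boundary

section Helpers

open Limits
open scoped AlgebraicGeometry

lemma aux_reduced_subscheme {Y : Scheme} (I : Y.IdealSheafData)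
    (h : ∀ U, (I.ideal U).IsRadical) : IsReduced I.subscheme := by
  have (i : Y.affineOpens) : IsReduced (I.subschemeCover.openCover.X i) := by
    have : _root_.IsReduced (Γ(Y, i.1) ⧸ I.ideal i) :=
      (Ideal.isRadical_iff_quotient_reduced _).mp (h i)
    exact inferInstanceAs (IsReduced (Spec (.of (Γ(Y, i.1) ⧸ I.ideal i))))
  have : ∀ i, IsReduced (I.subschemeCover.openCover.X i) := this
  exact IsReduced.of_openCover _ I.subschemeCover.openCover

lemma aux_reduced_image {A Y : Scheme} (g : A ⟶ Y) [QuasiCompact g] [IsReduced A] :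
    IsReduced g.image := by
  apply aux_reduced_subscheme
  intro U
  rw [Scheme.Hom.ker_apply]
  intro x hx
  obtain ⟨n, hn⟩ := hx
  rw [RingHom.mem_ker, map_pow] at hn
  exact RingHom.mem_ker.mpr (_root_.IsReduced.eq_zero _ ⟨n, hn⟩)

/-- Closed subsets carry a reduced closed subscheme structure. -/
lemma aux_exists_closed {Y : Scheme} (S : Set Y) (hS : IsClosed S) :
    ∃ (W : Scheme) (w : W ⟶ Y), IsReduced W ∧ IsClosedImmersion w ∧ Set.range w.base = S := by
  refine ⟨_, (Scheme.IdealSheafData.vanishingIdeal ⟨S, hS⟩).subschemeι,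
    aux_reduced_subscheme _ ?_, inferInstance, ?_⟩
  · intro U
    rw [Scheme.IdealSheafData.vanishingIdeal_ideal]
    exact PrimeSpectrum.isRadical_vanishingIdeal _
  · simp

/-- A morphism from a reduced scheme landing set-theoretically in a closed subscheme factors. -/
lemma aux_lift {A W Y : Scheme} (h : A ⟶ Y) (w : W ⟶ Y) [IsReduced A] [IsClosedImmersion w]
    (hr : Set.range h.base ⊆ Set.range w.base) : ∃ l : A ⟶ W, l ≫ w = h := by
  have : Surjective (pullback.snd w h) := by
    constructor
    rw [← Set.range_eq_univ, Scheme.Pullback.range_snd]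
    exact Set.preimage_eq_univ_iff.mpr hr
  have : IsIso (pullback.snd w h) := isIso_of_isClosedImmersion_of_surjective _
  exact ⟨inv (pullback.snd w h) ≫ pullback.fst w h, by simp [pullback.condition]⟩

lemma aux_preimage {A Y C : Scheme} (j : A ⟶ Y) (q : Y ⟶ C) [IsDominant j] [IsSeparated q]
    (a : A ⟶ C) (ha : j ≫ q = a) [IsOpenImmersion a] :
    q.base ⁻¹' (Set.range a.base) = Set.range j.base := by
  let s : A ⟶ pullback q a := pullback.lift j (𝟙 A) (by simp [ha])
  have hs1 : s ≫ pullback.fst q a = j := pullback.lift_fst _ _ _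
  have hs2 : s ≫ pullback.snd q a = 𝟙 A := pullback.lift_snd _ _ _
  have : IsClosedImmersion (s ≫ pullback.snd q a) := by rw [hs2]; infer_instance
  have hs : IsClosedImmersion s := .of_comp _ (pullback.snd q a)
  apply Set.Subset.antisymm
  · intro y hy
    rw [← Scheme.Pullback.range_fst] at hy
    obtain ⟨t, rfl⟩ := hy
    by_cases ht : t ∈ Set.range s.base
    · obtain ⟨x, rfl⟩ := ht
      exact ⟨x, by rw [← hs1]; rfl⟩
    · have ho : IsOpen ((pullback.fst q a).base '' (Set.range s.base)ᶜ) :=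
        (pullback.fst q a).isOpenEmbedding.isOpenMap _
          s.isClosedEmbedding.isClosed_range.isOpen_compl
      obtain ⟨y, ⟨t', ht', rfl⟩, x, hx⟩ :=
        (IsDominant.denseRange (f := j)).inter_open_nonempty _ ho ⟨_, t, ht, rfl⟩
      exfalso
      apply ht'
      refine ⟨x, (pullback.fst q a).isOpenEmbedding.injective ?_⟩
      rw [← hs1] at hx
      exact hx
  · rintro _ ⟨x, rfl⟩
    exact ⟨x, by rw [← ha]; rfl⟩


/-- A reduced scheme proper over a variety is a variety. -/
noncomputable def auxVar (V : Var k) (W : Scheme) (w : W ⟶ V.X) [hW : IsReduced W] [IsProper w] : Var k where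
  X := W
  str := w ≫ V.str
  reduced := hW
  separated := by have := V.separated; infer_instance
  locallyOfFiniteType := by have := V.locallyOfFiniteType; infer_instance
  quasiCompact := by have := V.quasiCompact; infer_instance

lemma aux_ac {X : Var k} {f : VarOver k X} (c₁ c₂ : Compactification f)
    (q : c₂.cpt.X ⟶ c₁.cpt.X) (hq : q ≫ c₁.p = c₂.p) (hj : c₂.j ≫ q = c₁.j)
    (hr : q.base ⁻¹' (Set.range c₁.j.base) = Set.range c₂.j.base) :
    c₂.diffClass = c₁.diffClass := by
  have hp1 := c₁.proper
  have hp2 : IsProper (q ≫ c₁.p) := hq ▸ c₂.proper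
  have hqp : IsProper q := .of_comp q c₁.p
  refine (QuotientAddGroup.eq_iff_sub_mem (N := AddSubgroup.closure (isoRelPr X ∪ acRel X))
    (x := FreeAbelianGroup.of c₂.total - FreeAbelianGroup.of c₂.boundary)
    (y := FreeAbelianGroup.of c₁.total - FreeAbelianGroup.of c₁.boundary)).mpr ?_
  apply AddSubgroup.subset_closure
  right; right
  have e1 : Set.range c₂.b.base = q.base ⁻¹' (Set.range c₁.b.base) := by
    rw [c₁.compl, c₂.compl, Set.preimage_compl, hr]
  have e2 : Set.range c₂.j.base = (Set.range c₂.b.base)ᶜ := by rw [c₂.compl, compl_compl]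
  have e3 : Set.range c₁.j.base = (Set.range c₁.b.base)ᶜ := by rw [c₁.compl, compl_compl]
  have e4 : c₂.j ≫ q = (Iso.refl f.src.X).hom ≫ c₁.j := by simpa using hj
  exact ⟨c₁.total, c₂.total, c₁.boundary, c₂.boundary, q, c₁.b, c₂.b, hqp, c₁.closedImm,
    c₂.closedImm, hq, rfl, rfl, e1, ⟨f.src, f.src, c₂.j, c₁.j, Iso.refl _, c₂.openImm, c₁.openImm,
      e2, e3, e4⟩, rfl⟩

lemma aux_indep {X : Var k} {f : VarOver k X} (c₁ c₂ : Compactification f) :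
    c₁.diffClass = c₂.diffClass := by
  have := c₁.proper
  have := c₂.proper
  have := c₁.openImm
  have := c₂.openImm
  have := f.src.reduced
  have := f.src.quasiCompact
  have := c₁.cpt.separated
  have hw1 : c₁.j ≫ c₁.cpt.str = f.src.str := by
    rw [← c₁.wp, ← Category.assoc, c₁.hj, f.w]
  have : QuasiCompact (c₁.j ≫ c₁.cpt.str) := by rw [hw1]; infer_instance
  have : QuasiCompact c₁.j := .of_comp _ c₁.cpt.str
  let g : f.src.X ⟶ pullback c₁.p c₂.p := pullback.lift c₁.j c₂.j (by rw [c₁.hj, c₂.hj])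
  have hg1 : g ≫ pullback.fst _ _ = c₁.j := pullback.lift_fst _ _ _
  have hg2 : g ≫ pullback.snd _ _ = c₂.j := pullback.lift_snd _ _ _
  have : IsImmersion (g ≫ pullback.fst c₁.p c₂.p) := by rw [hg1]; infer_instance
  have : IsImmersion g := .of_comp g (pullback.fst c₁.p c₂.p)
  have : QuasiCompact (g ≫ pullback.fst c₁.p c₂.p) := by rw [hg1]; infer_instance
  have : QuasiCompact g := .of_comp g (pullback.fst c₁.p c₂.p)
  have : IsReduced g.image := aux_reduced_image g
  let q₁ : g.image ⟶ c₁.cpt.X := g.imageι ≫ pullback.fst c₁.p c₂.p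
  let q₂ : g.image ⟶ c₂.cpt.X := g.imageι ≫ pullback.snd c₁.p c₂.p
  have h1 : g.toImage ≫ q₁ = c₁.j := by simp [q₁, hg1]
  have h2 : g.toImage ≫ q₂ = c₂.j := by simp [q₂, hg2]
  have hq : q₁ ≫ c₁.p = q₂ ≫ c₂.p := by simp [q₁, q₂, pullback.condition]
  have : IsProper q₁ := inferInstanceAs (IsProper (_ ≫ _))
  have : IsProper q₂ := inferInstanceAs (IsProper (_ ≫ _))
  obtain ⟨W, w, hW, hw, hr⟩ := aux_exists_closed (Set.range g.toImage.base)ᶜ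
    g.toImage.isOpenEmbedding.isOpen_range.isClosed_compl
  have hto : IsOpenImmersion g.toImage := inferInstance
  have hpp : IsProper (q₁ ≫ c₁.p) := inferInstance
  have hwq : IsProper (w ≫ q₁) := inferInstance
  have e1 : (q₁ ≫ c₁.p) ≫ X.str = q₁ ≫ c₁.cpt.str := by rw [Category.assoc, c₁.wp]
  have e2 : g.toImage ≫ q₁ ≫ c₁.p = f.hom := by rw [← Category.assoc, h1, c₁.hj]
  have e3 : w ≫ q₁ ≫ c₁.cpt.str = (w ≫ q₁) ≫ c₁.cpt.str := (Category.assoc _ _ _).symm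
  let c : Compactification f :=
    { cpt := auxVar c₁.cpt g.image q₁
      j := g.toImage
      openImm := hto
      p := q₁ ≫ c₁.p
      proper := hpp
      wp := e1
      hj := e2
      bd := auxVar c₁.cpt W (w ≫ q₁)
      b := w
      closedImm := hw
      wb := e3
      compl := hr }
  rw [← aux_ac c₁ c q₁ rfl h1 (aux_preimage g.toImage q₁ _ h1),
    ← aux_ac c₂ c q₂ hq.symm h2 (aux_preimage g.toImage q₂ _ h2)]

lemma aux_add {X : Var k} (f Z U : VarOver k X) (i : Z.src.X ⟶ f.src.X) (j : U.src.X ⟶ f.src.X)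
    (hi : IsClosedImmersion i) (hj : IsOpenImmersion j)
    (wi : i ≫ f.hom = Z.hom) (wj : j ≫ f.hom = U.hom)
    (hc : Set.range j.base = (Set.range i.base)ᶜ)
    (cf : Compactification f) (cz : Compactification Z) (cu : Compactification U) :
    cf.diffClass = cz.diffClass + cu.diffClass := by
  have := cf.proper
  have := cf.openImm
  have := cf.closedImm
  have := cf.bd.reduced
  have := Z.src.reduced
  obtain ⟨W, w, hW, hw, hr⟩ := aux_exists_closed (Set.range (j ≫ cf.j).base)ᶜ
    (j ≫ cf.j).isOpenEmbedding.isOpen_range.isClosed_compl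
  have hinj := cf.j.isOpenEmbedding.injective
  have hjr : Set.range (j ≫ cf.j).base = cf.j.base '' Set.range j.base := by
    rw [← Set.range_comp]; rfl
  have hir : Set.range (i ≫ cf.j).base = cf.j.base '' Set.range i.base := by
    rw [← Set.range_comp]; rfl
  obtain ⟨l, hl⟩ := aux_lift (i ≫ cf.j) w (by
    rw [hr, hir, hjr, hc]
    rintro _ ⟨x, hx, rfl⟩ ⟨y, hy, hxy⟩
    exact hy (hinj hxy ▸ hx))
  obtain ⟨b, hb⟩ := aux_lift cf.b w (by
    rw [hr, cf.compl, hjr, Set.compl_subset_compl]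
    exact Set.image_subset_range _ _)
  -- `l` is an open immersion
  have hlo : IsOpenImmersion l := by
    let s : Z.src.X ⟶ pullback w cf.j := pullback.lift l i hl
    have hs1 : s ≫ pullback.fst _ _ = l := pullback.lift_fst _ _ _
    have hs2 : s ≫ pullback.snd _ _ = i := pullback.lift_snd _ _ _
    have : IsClosedImmersion (s ≫ pullback.snd w cf.j) := by rw [hs2]; infer_instance
    have : IsClosedImmersion s := .of_comp _ (pullback.snd w cf.j)
    have : IsReduced (pullback w cf.j) := isReduced_of_isOpenImmersion (pullback.fst w cf.j)
    have : Surjective s := by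
      constructor
      intro t
      have ht : (pullback.snd w cf.j).base t ∈ Set.range i.base := by
        by_contra hn
        have h1 : (pullback.snd w cf.j).base t ∈ Set.range j.base := by rw [hc]; exact hn
        have h2 : w.base ((pullback.fst w cf.j).base t) ∈ Set.range w.base := ⟨_, rfl⟩
        have h3 : w.base ((pullback.fst w cf.j).base t) =
            cf.j.base ((pullback.snd w cf.j).base t) := by
          change (pullback.fst w cf.j ≫ w).base t = (pullback.snd w cf.j ≫ cf.j).base t
          rw [pullback.condition]
        rw [hr, hjr, h3] at h2
        exact h2 ⟨_, h1, rfl⟩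
      obtain ⟨z, hz⟩ := ht
      refine ⟨z, (pullback.snd w cf.j).isClosedEmbedding.injective ?_⟩
      rw [← hs2] at hz
      exact hz
    have : IsIso s := isIso_of_isClosedImmersion_of_surjective s
    rw [← hs1]
    infer_instance
  have hbc : IsClosedImmersion b := by
    have : IsClosedImmersion (b ≫ w) := by rw [hb]; infer_instance
    exact .of_comp b w
  have hwinj := w.isClosedEmbedding.injective
  have hbl : Set.range b.base = (Set.range l.base)ᶜ := by
    have e1 : Set.range cf.b.base = w.base '' Set.range b.base := by
      rw [← hb, ← Set.range_comp]; rfl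
    have e2 : Set.range (i ≫ cf.j).base = w.base '' Set.range l.base := by
      rw [← hl, ← Set.range_comp]; rfl
    apply Set.image_injective.mpr hwinj
    rw [Set.image_compl_eq_range_sdiff_image hwinj, ← e1, ← e2, hr, cf.compl, hjr, hir, hc]
    ext y
    simp only [Set.mem_compl_iff, Set.mem_range, Set.mem_sdiff, Set.mem_image]
    constructor
    · intro h
      exact ⟨fun ⟨x, _, hx⟩ => h ⟨x, hx⟩, fun ⟨x, _, hx⟩ => h ⟨x, hx⟩⟩
    · rintro ⟨h1, h2⟩ ⟨x, hx⟩
      by_cases hxi : ∃ z, i.base z = x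
      · exact h2 ⟨x, hxi, hx⟩
      · exact h1 ⟨x, hxi, hx⟩
  have e1 : IsProper (w ≫ cf.p) := inferInstance
  have e2 : (w ≫ cf.p) ≫ X.str = w ≫ cf.cpt.str := by rw [Category.assoc, cf.wp]
  have e3 : l ≫ w ≫ cf.p = Z.hom := by rw [← Category.assoc, hl, Category.assoc, cf.hj, wi]
  have e4 : b ≫ w ≫ cf.cpt.str = cf.bd.str := by rw [← cf.wb, ← hb, Category.assoc]
  let VW : Var k := auxVar cf.cpt W w
  let cz' : Compactification Z :=
    { cpt := VW
      j := l
      openImm := hlo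
      p := w ≫ cf.p
      proper := e1
      wp := e2
      hj := e3
      bd := cf.bd
      b := b
      closedImm := hbc
      wb := e4
      compl := hbl }
  let cu' : Compactification U :=
    { cpt := cf.cpt
      j := j ≫ cf.j
      openImm := inferInstance
      p := cf.p
      proper := inferInstance
      wp := cf.wp
      hj := by rw [Category.assoc, cf.hj, wj]
      bd := VW
      b := w
      closedImm := hw
      wb := rfl
      compl := hr }
  have hbd : cz'.boundary = cf.boundary := by
    have key : ∀ (h : cf.bd.X ⟶ X.X) (hh : h = cf.b ≫ cf.p) (a₁) (a₂),
        (PropOver.mk (VarOver.mk cf.bd h a₁) a₂ : PropOver X) = cf.boundary := by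
      rintro _ rfl _ _
      rfl
    exact key (b ≫ w ≫ cf.p) (by rw [← Category.assoc, hb]) _ _
  have ht : cu'.total = cf.total := rfl
  have htb : cu'.boundary = cz'.total := rfl
  rw [aux_indep cz cz', aux_indep cu cu']
  simp only [Compactification.diffClass, hbd, ht, htb]
  abel

end Helpers

/-- (i) the difference class `[X̄' → X] − [X̄'∖X' → X]` in
`Iso^pr(var/X)/(ac)` does not depend on the chosen compactification of `f : X' → X`;
(ii) writing `φ([f])` for this common class, `φ` is additive: for a closed subvariety
`Z ⊆ X'` with open complement `U = X'∖Z` one has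
`φ([X' → X]) = φ([Z → X]) + φ([X'∖Z → X])`. -/
theorem stmt_1 {X : Var k} (f : VarOver k X) :
    (∀ c₁ c₂ : Compactification f, c₁.diffClass = c₂.diffClass) ∧
    (∀ (Z U : VarOver k X) (i : Z.src.X ⟶ f.src.X) (j : U.src.X ⟶ f.src.X),
      IsClosedImmersion i → IsOpenImmersion j →
      i ≫ f.hom = Z.hom → j ≫ f.hom = U.hom →
      Set.range j.base = (Set.range i.base)ᶜ →
      ∀ (cf : Compactification f) (cz : Compactification Z) (cu : Compactification U),
        cf.diffClass = cz.diffClass + cu.diffClass) := by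
  exact ⟨aux_indep, fun Z U i j hi hj wi wj hc cf cz cu =>
    aux_add f Z U i j hi hj wi wj hc cf cz cu⟩
end
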